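/- arXiv:2208.04937 — 3 statements merged into one kernel-verified Lean document; each statement's English description precedes it below -/
import Mathlib

section
/- Convergence of the optimal-control Data-Driven solutions (Proposition 3.1): Let r : [0,T] → ℝ^{3N} be an exact trajectory. Suppose ε_h ≥ 0 is a sequence with ε_h → 0 and, for each h, there are twice continuously differentiable curves r_h, w_h : [0,T] → ℝ^{3N} and a curve s_h : [0,T] → ℝ^{3N} such that for all t ∈ [0,T]: (i) r_h(t) − s_h(t) + m ẅ_h(t) = 0; (ii) κ²( (f_ext(t) − m r̈_h(t)) − f(s_h(t)) ) + w_h(t) = 0; (iii) r_h(0) = r₀, ṙ_h(0) = v₀, w_h(0) = 0, ẇ_h(0) = 0; (iv) |r_h(t) − s_h(t)| ≤ ε_h. Then sup_{t ∈ [0,T]} |r_h(t) − r(t)| → 0 and sup_{t ∈ [0,T]} |ṙ_h(t) − ṙ(t)| → 0 as h → ∞; i.e., r_h converges to r strongly in W^{1,∞}((0,T); ℝ^{3N}). -/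
open Set Filter Topology

theorem gron_aux {E : Type*} [NormedAddCommGroup E] [NormedSpace ℝ E] (K T : ℝ) (hK : 0 ≤ K)
    (hT : 0 < T) : ∃ C : ℝ, 0 ≤ C ∧ ∀ (u : ℝ → E) (δ : ℝ), 0 ≤ δ → ContDiff ℝ 2 u → u 0 = 0 →
      deriv u 0 = 0 → (∀ t ∈ Icc (0 : ℝ) T, ‖deriv (deriv u) t‖ ≤ K * ‖u t‖ + δ) →
      ∀ t ∈ Icc (0 : ℝ) T, ‖u t‖ ≤ C * δ ∧ ‖deriv u t‖ ≤ C * δ := by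
  have hK1 : 0 < K + 1 := by linarith
  refine ⟨(Real.exp ((K + 1) * T) - 1) / (K + 1), ?_, ?_⟩
  · apply div_nonneg _ hK1.le
    have := Real.one_le_exp (x := (K + 1) * T) (by positivity)
    linarith
  intro u δ hδ hu h0 h1 hb t ht
  have hu1 : Differentiable ℝ u := hu.differentiable (by norm_num)
  have hu2 : ContDiff ℝ 1 (deriv u) := by
    have h2 : ContDiff ℝ (1 + 1) u := by simpa [one_add_one_eq_two] using hu
    exact (contDiff_succ_iff_deriv.1 h2).2.2
  have hu3 : Differentiable ℝ (deriv u) := hu2.differentiable (by norm_num)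
  have key := norm_le_gronwallBound_of_norm_deriv_right_le (f := fun t => (u t, deriv u t))
    (f' := fun t => (deriv u t, deriv (deriv u) t)) (δ := 0) (K := K + 1) (ε := δ) (a := 0) (b := T)
    (by exact (hu1.continuous.prodMk hu3.continuous).continuousOn)
    (fun x _ => ((hu1 x).hasDerivAt.prodMk (hu3 x).hasDerivAt).hasDerivWithinAt)
    (by simp [h0, h1])
    (by
      intro x hx
      have hb' := hb x ⟨hx.1, hx.2.le⟩
      have e1 := norm_fst_le (u x, deriv u x)
      have e2 := norm_snd_le (u x, deriv u x)
      simp only at e1 e2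
      have e0 := norm_nonneg (u x, deriv u x)
      refine norm_prod_le_iff.2 ⟨?_, ?_⟩
      · simp only; nlinarith
      · simp only; nlinarith [mul_le_mul_of_nonneg_left e1 hK]) t ht
  rw [gronwallBound_of_K_ne_0 hK1.ne'] at key
  have hexp : Real.exp ((K + 1) * (t - 0)) ≤ Real.exp ((K + 1) * T) := by
    apply Real.exp_le_exp.2
    apply mul_le_mul_of_nonneg_left _ hK1.le
    linarith [ht.2]
  have hfin : ‖(u t, deriv u t)‖ ≤ (Real.exp ((K + 1) * T) - 1) / (K + 1) * δ := by
    refine key.trans ?_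
    have e : (Real.exp ((K + 1) * T) - 1) / (K + 1) * δ =
        δ / (K + 1) * (Real.exp ((K + 1) * T) - 1) := by ring
    rw [e]
    beta_reduce
    rw [zero_mul, zero_add]
    exact mul_le_mul_of_nonneg_left (by linarith) (by positivity)
  exact ⟨(norm_fst_le (u t, deriv u t)).trans hfin, (norm_snd_le (u t, deriv u t)).trans hfin⟩

/-- Convergence of the optimal-control Data-Driven solutions (Proposition 3.1). -/
theorem optimal_control_data_driven_convergence
    (N : ℕ) (T m κ L : ℝ) (hT : 0 < T) (hm : 0 < m) (hκ : 0 < κ) (hL : 0 < L)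
    (f : EuclideanSpace ℝ (Fin (3 * N)) → EuclideanSpace ℝ (Fin (3 * N)))
    (hf : ∀ x y, ‖f x - f y‖ ≤ L * ‖x - y‖)
    (fext : ℝ → EuclideanSpace ℝ (Fin (3 * N))) (hfext : Continuous fext)
    (r₀ v₀ : EuclideanSpace ℝ (Fin (3 * N)))
    (r : ℝ → EuclideanSpace ℝ (Fin (3 * N))) (hr : ContDiff ℝ 2 r)
    (hreq : ∀ t ∈ Icc (0 : ℝ) T, m • deriv (deriv r) t + f (r t) = fext t)
    (hr0 : r 0 = r₀) (hv0 : deriv r 0 = v₀)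
    (ε : ℕ → ℝ) (hε : ∀ h, 0 ≤ ε h) (hε0 : Tendsto ε atTop (𝓝 0))
    (rh wh sh : ℕ → ℝ → EuclideanSpace ℝ (Fin (3 * N)))
    (hrh : ∀ h, ContDiff ℝ 2 (rh h)) (hwh : ∀ h, ContDiff ℝ 2 (wh h))
    (hEL1 : ∀ h, ∀ t ∈ Icc (0 : ℝ) T,
      rh h t - sh h t + m • deriv (deriv (wh h)) t = 0)
    (hEL2 : ∀ h, ∀ t ∈ Icc (0 : ℝ) T,
      (κ ^ 2) • ((fext t - m • deriv (deriv (rh h)) t) - f (sh h t)) + wh h t = 0)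
    (hic : ∀ h, rh h 0 = r₀ ∧ deriv (rh h) 0 = v₀ ∧ wh h 0 = 0 ∧ deriv (wh h) 0 = 0)
    (hsamp : ∀ h, ∀ t ∈ Icc (0 : ℝ) T, ‖rh h t - sh h t‖ ≤ ε h) :
    TendstoUniformlyOn rh r atTop (Icc 0 T) ∧
      TendstoUniformlyOn (fun h => deriv (rh h)) (deriv r) atTop (Icc 0 T) := by
  obtain ⟨C₁, hC₁, H₁⟩ := gron_aux (E := EuclideanSpace ℝ (Fin (3 * N))) 0 T le_rfl hT
  obtain ⟨C₂, hC₂, H₂⟩ := gron_aux (E := EuclideanSpace ℝ (Fin (3 * N))) (L / m) T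
    (by positivity) hT
  have hw : ∀ h, ∀ t ∈ Icc (0 : ℝ) T, ‖wh h t‖ ≤ C₁ * (ε h / m) := by
    intro h t ht
    refine (H₁ (wh h) (ε h / m) (div_nonneg (hε h) hm.le) (hwh h) (hic h).2.2.1 (hic h).2.2.2
      ?_ t ht).1
    intro t ht
    have e := hEL1 h t ht
    have e2 : m • deriv (deriv (wh h)) t = -(rh h t - sh h t) := by
      rw [eq_neg_iff_add_eq_zero, add_comm]; exact e
    have e3 := congrArg norm e2
    rw [norm_neg, norm_smul, Real.norm_of_nonneg hm.le] at e3
    rw [zero_mul, zero_add, le_div_iff₀ hm, mul_comm, e3]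
    exact hsamp h t ht
  set A : ℝ := (L + C₁ / m / κ ^ 2) / m with hA
  have hA0 : 0 ≤ A := by positivity
  have hu : ∀ h, ∀ t ∈ Icc (0 : ℝ) T, ‖rh h t - r t‖ ≤ C₂ * (A * ε h) ∧
      ‖deriv (rh h) t - deriv r t‖ ≤ C₂ * (A * ε h) := by
    intro h
    have d1 : ∀ t, DifferentiableAt ℝ (rh h) t := fun t =>
      ((hrh h).differentiable (by norm_num)) t
    have d2 : ∀ t, DifferentiableAt ℝ r t := fun t => (hr.differentiable (by norm_num)) t
    have hd : deriv (rh h - r) = deriv (rh h) - deriv r := by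
      funext t; exact deriv_sub (d1 t) (d2 t)
    have dd : ∀ g : ℝ → EuclideanSpace ℝ (Fin (3 * N)), ContDiff ℝ 2 g →
        Differentiable ℝ (deriv g) := by
      intro g hg
      have h2 : ContDiff ℝ (1 + 1) g := by simpa [one_add_one_eq_two] using hg
      exact (contDiff_succ_iff_deriv.1 h2).2.2.differentiable (by norm_num)
    have hdd : ∀ t, deriv (deriv (rh h - r)) t = deriv (deriv (rh h)) t - deriv (deriv r) t := by
      intro t; rw [hd]; exact deriv_sub (dd _ (hrh h) t) (dd _ hr t)
    have := H₂ (rh h - r) (A * ε h) (mul_nonneg hA0 (hε h)) ((hrh h).sub hr)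
      (by simp [hr0, (hic h).1]) (by rw [hd]; simp [hv0, (hic h).2.1]) ?_
    · rw [hd] at this
      exact this
    intro t ht
    rw [hdd, Pi.sub_apply]
    have e1 := hEL2 h t ht
    have e2 := hreq t ht
    have hk : (0 : ℝ) < κ ^ 2 := by positivity
    have e3 : m • (deriv (deriv (rh h)) t - deriv (deriv r) t) =
        (f (r t) - f (sh h t)) + (κ ^ 2)⁻¹ • wh h t := by
      have e4 : wh h t = - ((κ ^ 2) • ((fext t - m • deriv (deriv (rh h)) t) - f (sh h t))) := by
        rw [eq_neg_iff_add_eq_zero, add_comm]; exact e1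
      rw [e4, smul_neg, inv_smul_smul₀ hk.ne', ← e2, smul_sub]
      abel
    have e5 := congrArg norm e3
    rw [norm_smul, Real.norm_of_nonneg hm.le] at e5
    have e6 : ‖r t - sh h t‖ ≤ ‖rh h t - r t‖ + ε h := by
      have : r t - sh h t = (rh h t - sh h t) - (rh h t - r t) := by abel
      rw [this]
      refine (norm_sub_le _ _).trans ?_
      linarith [hsamp h t ht]
    have e7 : ‖(f (r t) - f (sh h t)) + (κ ^ 2)⁻¹ • wh h t‖ ≤
        L * (‖rh h t - r t‖ + ε h) + (κ ^ 2)⁻¹ * (C₁ * (ε h / m)) := by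
      refine (norm_add_le _ _).trans (add_le_add ?_ ?_)
      · exact (hf _ _).trans (mul_le_mul_of_nonneg_left e6 hL.le)
      · rw [norm_smul, Real.norm_of_nonneg (inv_pos.2 hk).le]
        exact mul_le_mul_of_nonneg_left (hw h t ht) (inv_pos.2 hk).le
    rw [← e5] at e7
    have e8 : L / m * ‖rh h t - r t‖ + A * ε h =
        (L * (‖rh h t - r t‖ + ε h) + (κ ^ 2)⁻¹ * (C₁ * (ε h / m))) / m := by
      rw [hA]; field_simp; ring
    rw [e8, le_div_iff₀ hm, mul_comm]
    exact e7
  have hlim : Tendsto (fun h => C₂ * (A * ε h)) atTop (𝓝 0) := by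
    simpa using (hε0.const_mul A).const_mul C₂
  constructor
  · rw [Metric.tendstoUniformlyOn_iff]
    intro e he
    filter_upwards [hlim.eventually (gt_mem_nhds he)] with h hh t ht
    rw [dist_comm, dist_eq_norm]
    exact (hu h t ht).1.trans_lt hh
  · rw [Metric.tendstoUniformlyOn_iff]
    intro e he
    filter_upwards [hlim.eventually (gt_mem_nhds he)] with h hh t ht
    rw [dist_comm, dist_eq_norm]
    exact (hu h t ht).2.trans_lt hh
end

section
/- Convergence of the game-theoretical Data-Driven solutions (Proposition 3.2): Let r : [0,T] → ℝ^{3N} be an exact trajectory. Suppose ε_h ≥ 0 is a sequence with ε_h → 0 and, for each h, there are a twice continuously differentiable curve r_h : [0,T] → ℝ^{3N} and a curve s_h : [0,T] → ℝ^{3N} such that for all t ∈ [0,T]: (i) m r̈_h(t) + f(s_h(t)) = f_ext(t); (ii) r_h(0) = r₀, ṙ_h(0) = v₀; (iii) |r_h(t) − s_h(t)| ≤ ε_h. Then sup_{t ∈ [0,T]} |r_h(t) − r(t)| → 0 and sup_{t ∈ [0,T]} |ṙ_h(t) − ṙ(t)| → 0 as h → ∞; i.e., r_h converges to r strongly in W^{1,∞}((0,T);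 ℝ^{3N}). -/
open Set Filter Topology

/-- Convergence of the game-theoretical Data-Driven solutions (Proposition 3.2). -/
theorem game_theoretical_data_driven_convergence
    (N : ℕ) (T m L : ℝ) (hT : 0 < T) (hm : 0 < m) (hL : 0 < L)
    (f : EuclideanSpace ℝ (Fin (3 * N)) → EuclideanSpace ℝ (Fin (3 * N)))
    (hf : ∀ x y, ‖f x - f y‖ ≤ L * ‖x - y‖)
    (fext : ℝ → EuclideanSpace ℝ (Fin (3 * N))) (hfext : Continuous fext)
    (r₀ v₀ : EuclideanSpace ℝ (Fin (3 * N)))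
    (r : ℝ → EuclideanSpace ℝ (Fin (3 * N))) (hr : ContDiff ℝ 2 r)
    (hreq : ∀ t ∈ Icc (0 : ℝ) T, m • deriv (deriv r) t + f (r t) = fext t)
    (hr0 : r 0 = r₀) (hv0 : deriv r 0 = v₀)
    (ε : ℕ → ℝ) (hε : ∀ h, 0 ≤ ε h) (hε0 : Tendsto ε atTop (𝓝 0))
    (rh sh : ℕ → ℝ → EuclideanSpace ℝ (Fin (3 * N)))
    (hrh : ∀ h, ContDiff ℝ 2 (rh h))
    (hEL : ∀ h, ∀ t ∈ Icc (0 : ℝ) T,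
      m • deriv (deriv (rh h)) t + f (sh h t) = fext t)
    (hic : ∀ h, rh h 0 = r₀ ∧ deriv (rh h) 0 = v₀)
    (hsamp : ∀ h, ∀ t ∈ Icc (0 : ℝ) T, ‖rh h t - sh h t‖ ≤ ε h) :
    TendstoUniformlyOn rh r atTop (Icc 0 T) ∧
      TendstoUniformlyOn (fun h => deriv (rh h)) (deriv r) atTop (Icc 0 T) := by
  have hd : ∀ q : ℝ → EuclideanSpace ℝ (Fin (3 * N)), ContDiff ℝ 2 q →
      (∀ t, HasDerivAt q (deriv q t) t) ∧ (∀ t, HasDerivAt (deriv q) (deriv (deriv q) t) t) := by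
    intro q hq
    have h2 : ContDiff ℝ (1 + 1) q := by
      rw [one_add_one_eq_two]
      exact hq
    have h1 : ContDiff ℝ 1 (deriv q) := (contDiff_succ_iff_deriv.1 h2).2.2
    exact ⟨fun t => (hq.differentiable (by norm_num) t).hasDerivAt,
      fun t => (h1.differentiable (by norm_num) t).hasDerivAt⟩
  have hLm : 0 < L / m := div_pos hL hm
  have key : ∀ h, ∀ t ∈ Icc (0 : ℝ) T,
      ‖(rh h t - r t, deriv (rh h) t - deriv r t)‖
        ≤ gronwallBound 0 (1 + L / m) (L / m * ε h) T := by
    intro h t ht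
    have hder : ∀ x, HasDerivAt (fun t => (rh h t - r t, deriv (rh h) t - deriv r t))
        (deriv (rh h) x - deriv r x, deriv (deriv (rh h)) x - deriv (deriv r) x) x := fun x =>
      (((hd _ (hrh h)).1 x).sub ((hd _ hr).1 x)).prodMk
        (((hd _ (hrh h)).2 x).sub ((hd _ hr).2 x))
    have hE : 0 ≤ L / m * ε h := mul_nonneg hLm.le (hε h)
    have main := norm_le_gronwallBound_of_norm_deriv_right_le (δ := 0) (K := 1 + L / m)
      (ε := L / m * ε h) (a := 0) (b := T)
      (fun x _ => (hder x).continuousAt.continuousWithinAt)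
      (fun x _ => (hder x).hasDerivWithinAt)
      (by simp [(hic h).1, (hic h).2, hr0, hv0])
      (by
        intro x hx
        have hx' : x ∈ Icc (0 : ℝ) T := ⟨hx.1, hx.2.le⟩
        set P := (rh h x - r x, deriv (rh h) x - deriv r x) with hP
        have hP1 : ‖rh h x - r x‖ ≤ ‖P‖ := norm_fst_le P
        have hP2 : ‖deriv (rh h) x - deriv r x‖ ≤ ‖P‖ := norm_snd_le P
        have hP0 : 0 ≤ ‖P‖ := norm_nonneg P
        have hLP : 0 ≤ L / m * ‖P‖ := mul_nonneg hLm.le hP0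
        rw [Prod.norm_mk]
        apply max_le
        · linarith
        · have e : m • (deriv (deriv (rh h)) x - deriv (deriv r) x)
              = f (r x) - f (sh h x) := by
            have e1 := hEL h x hx'
            have e2 := hreq x hx'
            rw [smul_sub, eq_sub_of_add_eq e1, eq_sub_of_add_eq e2]
            abel
          have e3 : m * ‖deriv (deriv (rh h)) x - deriv (deriv r) x‖
              ≤ L * (‖P‖ + ε h) := by
            calc m * ‖deriv (deriv (rh h)) x - deriv (deriv r) x‖
                = ‖f (r x) - f (sh h x)‖ := by
                  rw [← e, norm_smul, Real.norm_of_nonneg hm.le]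
              _ ≤ L * ‖r x - sh h x‖ := hf _ _
              _ ≤ L * (‖P‖ + ε h) := by
                  apply mul_le_mul_of_nonneg_left _ hL.le
                  have := norm_sub_le_norm_sub_add_norm_sub (r x) (rh h x) (sh h x)
                  rw [norm_sub_rev (r x) (rh h x)] at this
                  linarith [hsamp h x hx']
          have e4 : ‖deriv (deriv (rh h)) x - deriv (deriv r) x‖
              ≤ L * (‖P‖ + ε h) / m := by
            rw [le_div_iff₀ hm]
            linarith
          have e5 : L * (‖P‖ + ε h) / m = L / m * ‖P‖ + L / m * ε h := by ring
          linarith)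
    refine (main t ht).trans (gronwallBound_mono le_rfl hE (by linarith) ?_)
    linarith [ht.2]
  have hlim : Tendsto (fun h => gronwallBound 0 (1 + L / m) (L / m * ε h) T) atTop (𝓝 0) := by
    have h1 : Tendsto (fun h => L / m * ε h) atTop (𝓝 0) := by
      simpa using hε0.const_mul (L / m)
    have h2 := ((gronwallBound_continuous_ε 0 (1 + L / m) T).tendsto 0).comp h1
    rw [gronwallBound_ε0_δ0] at h2
    exact h2
  constructor
  · rw [Metric.tendstoUniformlyOn_iff]
    intro η hη
    filter_upwards [hlim.eventually (gt_mem_nhds hη)] with h hh t ht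
    rw [dist_comm, dist_eq_norm]
    exact ((norm_fst_le _).trans (key h t ht)).trans_lt hh
  · rw [Metric.tendstoUniformlyOn_iff]
    intro η hη
    filter_upwards [hlim.eventually (gt_mem_nhds hη)] with h hh t ht
    rw [dist_comm, dist_eq_norm]
    exact ((norm_snd_le _).trans (key h t ht)).trans_lt hh
end

section
/- Frequency-error identity for the weighted L² norm: For all ω', ω'' > 0 and every A ∈ ℝ, the improper integral ∫₀^∞ (A sin(ω' t) − A sin(ω'' t))² / t² dt converges and equals (π/2) A² |ω' − ω''|. -/
open Real Set MeasureTheory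

lemma aux_inner (s : ℝ) (hs : 0 < s) :
    IntegrableOn (fun t => (1 - cos t) * (s * exp (-(t * s)))) (Ioi 0) ∧
    ∫ t in Ioi (0 : ℝ), (1 - cos t) * (s * exp (-(t * s))) = (1 + s ^ 2)⁻¹ := by
  have hne : (1 + s ^ 2) ≠ 0 := by positivity
  have hd : ∀ x ∈ Ici (0 : ℝ), HasDerivAt
      (fun t => -(exp (-(t * s)) * (1 + s * (sin t - s * cos t) / (1 + s ^ 2))))
      ((1 - cos x) * (s * exp (-(x * s)))) x := by
    intro x _
    have h1 : HasDerivAt (fun t : ℝ => exp (-(t * s))) (exp (-(x * s)) * (-(1 * s))) x :=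
      (((hasDerivAt_id x).mul_const s).neg).exp
    have h2 : HasDerivAt (fun t : ℝ => 1 + s * (sin t - s * cos t) / (1 + s ^ 2))
        (s * (cos x - s * (- sin x)) / (1 + s ^ 2)) x :=
      ((((hasDerivAt_sin x).sub ((hasDerivAt_cos x).const_mul s)).const_mul s).div_const _).const_add 1
    refine (h1.mul h2).neg.congr_deriv ?_
    field_simp
    ring
  have hpos : ∀ x ∈ Ioi (0 : ℝ), 0 ≤ (1 - cos x) * (s * exp (-(x * s))) := by
    intro x _
    have := cos_le_one x
    have : 0 ≤ 1 - cos x := by linarith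
    positivity
  have hl : Filter.Tendsto
      (fun t => -(exp (-(t * s)) * (1 + s * (sin t - s * cos t) / (1 + s ^ 2))))
      Filter.atTop (nhds 0) := by
    have he : Filter.Tendsto (fun t : ℝ => exp (-(t * s))) Filter.atTop (nhds 0) :=
      tendsto_exp_neg_atTop_nhds_zero.comp (Filter.tendsto_id.atTop_mul_const hs)
    have hb := he.zero_mul_isBoundedUnder_le
      (g := fun t => (1 + s * (sin t - s * cos t) / (1 + s ^ 2))) (by
        refine Filter.isBoundedUnder_of ⟨1 + s * (1 + s) / (1 + s ^ 2), fun t => ?_⟩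
        simp only [Function.comp, norm_eq_abs]
        refine (abs_add_le _ _).trans ?_
        rw [abs_one, abs_div, abs_mul, abs_of_pos hs, abs_of_pos (by positivity : 0 < 1 + s ^ 2)]
        gcongr
        refine (abs_sub _ _).trans ?_
        rw [abs_mul, abs_of_pos hs]
        have := abs_sin_le_one t
        have := abs_cos_le_one t
        nlinarith)
    simpa using hb.neg
  refine ⟨integrableOn_Ioi_deriv_of_nonneg' hd hpos hl, ?_⟩
  rw [integral_Ioi_of_hasDerivAt_of_nonneg' hd hpos hl]
  simp
  field_simp
  ring

lemma aux_outer (t : ℝ) (ht : 0 < t) :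
    ∫ s in Ioi (0 : ℝ), (1 - cos t) * (s * exp (-(t * s))) = (1 - cos t) / t ^ 2 := by
  rw [integral_const_mul]
  have h := Real.integral_rpow_mul_exp_neg_mul_Ioi (a := 2) (r := t) (by norm_num) ht
  have h2 : Real.Gamma 2 = 1 := by
    simp
  have e : (2 : ℝ) - 1 = 1 := by norm_num
  simp only [e, Real.rpow_one, h2] at h
  rw [h, Real.rpow_two]
  field_simp

lemma aux_main : IntegrableOn (fun t => (1 - cos t) / t ^ 2) (Ioi 0) ∧
    ∫ t in Ioi (0 : ℝ), (1 - cos t) / t ^ 2 = π / 2 := by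
  have hI : Integrable (Function.uncurry fun t s : ℝ => (1 - cos t) * (s * exp (-(t * s))))
      ((volume.restrict (Ioi 0)).prod (volume.restrict (Ioi 0))) := by
    rw [integrable_prod_iff' (by
      apply Continuous.aestronglyMeasurable
      unfold Function.uncurry
      fun_prop)]
    constructor
    · filter_upwards [ae_restrict_mem measurableSet_Ioi] with s hs
      exact (aux_inner s hs).1
    · have h0 : Integrable (fun s : ℝ => (1 + s ^ 2)⁻¹) (volume.restrict (Ioi 0)) :=
        integrable_inv_one_add_sq.restrict
      refine h0.congr ?_
      filter_upwards [ae_restrict_mem measurableSet_Ioi] with s hs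
      rw [← (aux_inner s hs).2]
      congr 1
      ext t
      have := cos_le_one t
      have h1 : 0 ≤ 1 - cos t := by linarith
      have hs' : 0 < s := hs
      simp only [Function.uncurry]
      rw [norm_of_nonneg (by positivity)]
  have hc : ∀ᵐ t ∂(volume.restrict (Ioi (0 : ℝ))),
      ∫ s in Ioi (0 : ℝ), (1 - cos t) * (s * exp (-(t * s))) = (1 - cos t) / t ^ 2 := by
    filter_upwards [ae_restrict_mem measurableSet_Ioi] with t ht
    exact aux_outer t ht
  refine ⟨hI.integral_prod_left.congr hc, ?_⟩
  rw [← integral_congr_ae hc, integral_integral_swap hI]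
  rw [setIntegral_congr_fun measurableSet_Ioi (fun s hs => (aux_inner s hs).2)]
  simp

lemma aux_scale (c : ℝ) : IntegrableOn (fun t => (1 - cos (c * t)) / t ^ 2) (Ioi 0) ∧
    ∫ t in Ioi (0 : ℝ), (1 - cos (c * t)) / t ^ 2 = π / 2 * |c| := by
  rcases eq_or_ne c 0 with rfl | hc
  · simp
  have hp : 0 < |c| := abs_pos.mpr hc
  have e : (fun t => (1 - cos (c * t)) / t ^ 2) =
      fun t => |c| ^ 2 * ((1 - cos (|c| * t)) / (|c| * t) ^ 2) := by
    ext t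
    have : cos (c * t) = cos (|c| * t) := by
      rcases abs_choice c with h | h <;> rw [h]
      rw [neg_mul, cos_neg]
    rw [this]
    rcases eq_or_ne t 0 with rfl | ht
    · simp
    · field_simp
  rw [e]
  constructor
  · refine Integrable.const_mul ?_ _
    have := (integrableOn_Ioi_comp_mul_left_iff (fun t => (1 - cos t) / t ^ 2) 0 hp).2
      (by simpa using aux_main.1)
    exact this
  · rw [integral_const_mul, integral_comp_mul_left_Ioi (fun t => (1 - cos t) / t ^ 2) 0 hp,
      mul_zero, aux_main.2, smul_eq_mul]
    field_simp

/-- Frequency-error identity for the weighted L² norm. -/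
theorem weighted_norm_frequency_error
    (ω' ω'' : ℝ) (hω' : 0 < ω') (hω'' : 0 < ω'') (A : ℝ) :
    IntegrableOn (fun t => (A * sin (ω' * t) - A * sin (ω'' * t)) ^ 2 / t ^ 2)
      (Ioi 0) ∧
    ∫ t in Ioi (0 : ℝ), (A * sin (ω' * t) - A * sin (ω'' * t)) ^ 2 / t ^ 2
      = π / 2 * A ^ 2 * |ω' - ω''| := by
  have e : (fun t => (A * sin (ω' * t) - A * sin (ω'' * t)) ^ 2 / t ^ 2) = fun t =>
      A ^ 2 * ((((1 / 2) * ((1 - cos ((2 * ω') * t)) / t ^ 2)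
        + (1 / 2) * ((1 - cos ((2 * ω'') * t)) / t ^ 2))
        + (1 - cos ((ω' - ω'') * t)) / t ^ 2) - (1 - cos ((ω' + ω'') * t)) / t ^ 2) := by
    ext t
    rw [mul_assoc 2, mul_assoc 2, sub_mul, add_mul, cos_two_mul, cos_two_mul, cos_sub, cos_add,
      cos_sq', cos_sq']
    ring
  obtain ⟨i1, v1⟩ := aux_scale (2 * ω')
  obtain ⟨i2, v2⟩ := aux_scale (2 * ω'')
  obtain ⟨i3, v3⟩ := aux_scale (ω' - ω'')
  obtain ⟨i4, v4⟩ := aux_scale (ω' + ω'')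
  have j1 := Integrable.const_mul i1 (1 / 2)
  have j2 := Integrable.const_mul i2 (1 / 2)
  rw [e]
  refine ⟨Integrable.const_mul (((j1.add j2).add i3).sub i4) _, ?_⟩
  rw [integral_const_mul, integral_sub (by exact (j1.add j2).add i3) i4,
    integral_add (by exact j1.add j2) i3,
    integral_add j1 j2, integral_const_mul, integral_const_mul, v1, v2, v3, v4,
    abs_of_pos (by positivity : 0 < 2 * ω'), abs_of_pos (by positivity : 0 < 2 * ω''),
    abs_of_pos (by positivity : 0 < ω' + ω'')]
  ring
end
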